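/- Let Q be a convex quadrilateral that is a midpoint diagonal quadrilateral. Then every ellipse inscribed in Q has a (unique) pair of conjugate diameters parallel to the two diagonals of Q. -/

import Mathlib

/-- Convex quadrilateral with vertices in cyclic order: no three consecutive
vertices collinear and the diagonals cross. -/
def ConvexQuad (A₁ A₂ A₃ A₄ : ℝ × ℝ) : Prop :=
  AffineIndependent ℝ ![A₁, A₂, A₃] ∧ AffineIndependent ℝ ![A₂, A₃, A₄] ∧
  AffineIndependent ℝ ![A₃, A₄, A₁] ∧ AffineIndependent ℝ ![A₄, A₁, A₂] ∧
  ∃ P : ℝ × ℝ, P ∈ openSegment ℝ A₁ A₃ ∧ P ∈ openSegment ℝ A₂ A₄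

/-- Midpoint diagonal quadrilateral. -/
def IsMidpointDiagonalQuad (A₁ A₂ A₃ A₄ : ℝ × ℝ) : Prop :=
  ∃ P : ℝ × ℝ, P ∈ openSegment ℝ A₁ A₃ ∧ P ∈ openSegment ℝ A₂ A₄ ∧
    (P = midpoint ℝ A₁ A₃ ∨ P = midpoint ℝ A₂ A₄)

/-- The unit circle. -/
def unitCircle : Set (ℝ × ℝ) := {p : ℝ × ℝ | p.1 ^ 2 + p.2 ^ 2 = 1}

/-- The ellipse `f '' unitCircle` (with center `f 0`) is inscribed in the
quadrilateral `A₁A₂A₃A₄`: it lies inside the quadrilateral and touches each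
of the four sides. -/
def InscribedEllipse (f : (ℝ × ℝ) ≃ᵃ[ℝ] (ℝ × ℝ)) (A₁ A₂ A₃ A₄ : ℝ × ℝ) : Prop :=
  f '' unitCircle ⊆ convexHull ℝ {A₁, A₂, A₃, A₄} ∧
  (∃ p ∈ f '' unitCircle, p ∈ segment ℝ A₁ A₂) ∧
  (∃ p ∈ f '' unitCircle, p ∈ segment ℝ A₂ A₃) ∧
  (∃ p ∈ f '' unitCircle, p ∈ segment ℝ A₃ A₄) ∧
  (∃ p ∈ f '' unitCircle, p ∈ segment ℝ A₄ A₁)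

/-- The diameters of the ellipse `S` with center `c` in the directions `u` and
`v` are conjugate: the midpoint of every chord of `S` parallel to `u` lies on
the line through `c` with direction `v`. -/
def ConjugateDiameters (S : Set (ℝ × ℝ)) (c u v : ℝ × ℝ) : Prop :=
  u ≠ 0 ∧ v ≠ 0 ∧
    ∀ p q, p ∈ S → q ∈ S → p ≠ q → (∃ t : ℝ, p - q = t • u) →
      ∃ t : ℝ, midpoint ℝ p q = c + t • v

/-- The signed area spanned by two vectors of the plane. -/
def planeCross (x y : ℝ × ℝ) : ℝ := x.1 * y.2 - x.2 * y.1

/-- The standard scalar product of the plane. -/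
def planeDot (x y : ℝ × ℝ) : ℝ := x.1 * y.1 + x.2 * y.2

/-- An affine function that is nonnegative on the unit circle and vanishes at a point of it has
its gradient along the radius through that point. -/
lemma gradient_eq_of_nonneg_on_unitCircle {a m n : ℝ} {T : ℝ × ℝ} (hT : T ∈ unitCircle)
    (h : ∀ x ∈ unitCircle, 0 ≤ a + m * x.1 + n * x.2) (h0 : a + m * T.1 + n * T.2 = 0) :
    0 ≤ a ∧ m = -a * T.1 ∧ n = -a * T.2 := by
  have hT' : T.1 ^ 2 + T.2 ^ 2 = 1 := hT
  have ha : 0 ≤ a := by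
    have := h (-T.1, -T.2) (by simpa [unitCircle] using hT')
    dsimp only at this
    linarith
  have hle : m ^ 2 + n ^ 2 ≤ a ^ 2 := by
    rcases eq_or_ne (m ^ 2 + n ^ 2) 0 with h' | h'
    · rw [h']; positivity
    · have hpos : 0 < m ^ 2 + n ^ 2 := lt_of_le_of_ne (by positivity) h'.symm
      have hr : 0 < √(m ^ 2 + n ^ 2) := Real.sqrt_pos.2 hpos
      have hsq : √(m ^ 2 + n ^ 2) ^ 2 = m ^ 2 + n ^ 2 := Real.sq_sqrt hpos.le
      set r := √(m ^ 2 + n ^ 2)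
      have hx := h (-m / r, -n / r) (by
        simp only [unitCircle, Set.mem_ofPred_eq]
        field_simp
        linarith)
      have hxr : a + m * (-m / r) + n * (-n / r) = a - r := by
        field_simp
        linarith
      have hra : r ≤ a := by
        dsimp only at hx
        linarith
      nlinarith
  have hsum : (m + a * T.1) ^ 2 + (n + a * T.2) ^ 2 ≤ 0 := by
    have : (m + a * T.1) ^ 2 + (n + a * T.2) ^ 2 =
        m ^ 2 + n ^ 2 - a ^ 2 + 2 * a * (a + m * T.1 + n * T.2)
          + a ^ 2 * (T.1 ^ 2 + T.2 ^ 2 - 1) := by ring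
    rw [this, h0, hT']
    linarith
  have h1 : m + a * T.1 = 0 := by
    have : (m + a * T.1) ^ 2 = 0 :=
      le_antisymm (by nlinarith [sq_nonneg (n + a * T.2)]) (sq_nonneg _)
    exact pow_eq_zero_iff two_ne_zero |>.1 this
  have h2 : n + a * T.2 = 0 := by
    have : (n + a * T.2) ^ 2 = 0 :=
      le_antisymm (by nlinarith [sq_nonneg (m + a * T.1)]) (sq_nonneg _)
    exact pow_eq_zero_iff two_ne_zero |>.1 this
  exact ⟨ha, by linarith, by linarith⟩

/-- If the unit circle touches the segment `XY` and stays on one side of its line, then the signed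
tangent lengths `p`, `q` from `X` and `Y` add up to the signed length of the segment. -/
lemma exists_tangent_lengths {D : ℝ} (hD : D ≠ 0) {X Y T : ℝ × ℝ} (hT : T ∈ unitCircle)
    (hTs : T ∈ segment ℝ X Y)
    (h : ∀ x ∈ unitCircle, 0 ≤ D * planeCross (Y - X) (x - X)) :
    ∃ p q : ℝ, 0 ≤ D * p ∧ 0 ≤ D * q ∧ planeCross X Y = p + q ∧
      planeDot X X = 1 + p ^ 2 ∧ planeDot Y Y = 1 + q ^ 2 ∧
      planeDot (Y - X) (Y - X) = (p + q) ^ 2 := by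
  obtain ⟨x₁, x₂⟩ := X
  obtain ⟨y₁, y₂⟩ := Y
  obtain ⟨r, s, hr, hs, hrs, rfl⟩ := hTs
  simp only [planeCross, planeDot, Prod.fst_sub, Prod.snd_sub] at h ⊢
  have hT' : (r * x₁ + s * y₁) ^ 2 + (r * x₂ + s * y₂) ^ 2 = 1 := by
    simpa [unitCircle] using hT
  obtain ⟨ha, hm, hn⟩ := gradient_eq_of_nonneg_on_unitCircle
    (a := D * (x₁ * y₂ - x₂ * y₁)) (m := -(D * (y₂ - x₂))) (n := D * (y₁ - x₁)) hT
    (fun x hx => by linarith [h x hx])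
    (by
      obtain rfl : r = 1 - s := by linarith
      simp only [Prod.fst_add, Prod.snd_add, Prod.smul_fst, Prod.smul_snd, smul_eq_mul]
      ring)
  simp only [Prod.fst_add, Prod.snd_add, Prod.smul_fst, Prod.smul_snd, smul_eq_mul] at hm hn
  set c := x₁ * y₂ - x₂ * y₁
  set t₁ := r * x₁ + s * y₁ with ht₁
  set t₂ := r * x₂ + s * y₂ with ht₂
  have h2 : y₂ - x₂ = c * t₁ := mul_left_cancel₀ hD (by linarith)
  have h1 : y₁ - x₁ = -(c * t₂) := mul_left_cancel₀ hD (by linarith)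
  obtain rfl : r = 1 - s := by linarith
  have hx1 : x₁ = t₁ + s * c * t₂ := by linear_combination -ht₁ - s * h1
  have hx2 : x₂ = t₂ - s * c * t₁ := by linear_combination -ht₂ - s * h2
  have hy1 : y₁ = t₁ - (1 - s) * c * t₂ := by linear_combination -ht₁ + (1 - s) * h1
  have hy2 : y₂ = t₂ + (1 - s) * c * t₁ := by linear_combination -ht₂ + (1 - s) * h2
  refine ⟨s * c, (1 - s) * c, ?_, ?_, by ring, ?_, ?_, ?_⟩
  · nlinarith [mul_nonneg hs ha]
  · nlinarith [mul_nonneg hr ha]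
  · rw [hx1, hx2]
    linear_combination (1 + s ^ 2 * c ^ 2) * hT'
  · rw [hy1, hy2]
    linear_combination (1 + (1 - s) ^ 2 * c ^ 2) * hT'
  · rw [h1, h2]
    linear_combination c ^ 2 * hT'

/-- Two numbers with equal squares that have the same sign are equal. -/
lemma eq_of_sq_eq_of_mul_nonneg {D p q : ℝ} (hD : D ≠ 0) (hp : 0 ≤ D * p) (hq : 0 ≤ D * q)
    (h : p ^ 2 = q ^ 2) : p = q :=
  mul_left_cancel₀ hD ((sq_eq_sq₀ hp hq).1 (by rw [mul_pow, mul_pow, h]))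

/-- Let `XYZW` be circumscribed about the unit circle and let the midpoint of `XZ` lie on the
line `YW`. Then the diagonals are perpendicular. -/
lemma planeDot_diagonals_eq_zero {D t : ℝ} (hD : D ≠ 0) {X Y Z W : ℝ × ℝ}
    {T₁ T₂ T₃ T₄ : ℝ × ℝ} (hT₁ : T₁ ∈ unitCircle) (hT₂ : T₂ ∈ unitCircle)
    (hT₃ : T₃ ∈ unitCircle) (hT₄ : T₄ ∈ unitCircle)
    (hs₁ : T₁ ∈ segment ℝ X Y) (hs₂ : T₂ ∈ segment ℝ Y Z)
    (hs₃ : T₃ ∈ segment ℝ Z W) (hs₄ : T₄ ∈ segment ℝ W X)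
    (h₁ : ∀ x ∈ unitCircle, 0 ≤ D * planeCross (Y - X) (x - X))
    (h₂ : ∀ x ∈ unitCircle, 0 ≤ D * planeCross (Z - Y) (x - Y))
    (h₃ : ∀ x ∈ unitCircle, 0 ≤ D * planeCross (W - Z) (x - Z))
    (h₄ : ∀ x ∈ unitCircle, 0 ≤ D * planeCross (X - W) (x - W))
    (hM : X + Z = (2 : ℝ) • ((1 - t) • Y + t • W)) :
    planeDot (Z - X) (W - Y) = 0 := by
  obtain ⟨p₁, q₁, hp₁, hq₁, hc₁, hX₁, hY₁, hl₁⟩ := exists_tangent_lengths hD hT₁ hs₁ h₁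
  obtain ⟨p₂, q₂, hp₂, hq₂, hc₂, hY₂, hZ₂, hl₂⟩ := exists_tangent_lengths hD hT₂ hs₂ h₂
  obtain ⟨p₃, q₃, hp₃, hq₃, hc₃, hZ₃, hW₃, hl₃⟩ := exists_tangent_lengths hD hT₃ hs₃ h₃
  obtain ⟨p₄, q₄, hp₄, hq₄, hc₄, hW₄, hX₄, hl₄⟩ := exists_tangent_lengths hD hT₄ hs₄ h₄
  obtain rfl : p₂ = q₁ := eq_of_sq_eq_of_mul_nonneg hD hp₂ hq₁ (by linarith)
  obtain rfl : p₃ = q₂ := eq_of_sq_eq_of_mul_nonneg hD hp₃ hq₂ (by linarith)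
  obtain rfl : p₄ = q₃ := eq_of_sq_eq_of_mul_nonneg hD hp₄ hq₃ (by linarith)
  obtain rfl : q₄ = p₁ := eq_of_sq_eq_of_mul_nonneg hD hq₄ hp₁ (by linarith)
  obtain ⟨x₁, x₂⟩ := X
  obtain ⟨y₁, y₂⟩ := Y
  obtain ⟨z₁, z₂⟩ := Z
  obtain ⟨w₁, w₂⟩ := W
  simp only [planeDot, planeCross, Prod.mk_add_mk, Prod.smul_mk, Prod.mk.injEq,
    Prod.mk_sub_mk, smul_eq_mul] at *
  obtain ⟨hM₁, hM₂⟩ := hM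
  obtain rfl : z₁ = 2 * ((1 - t) * y₁ + t * w₁) - x₁ := by linarith
  obtain rfl : z₂ = 2 * ((1 - t) * y₂ + t * w₂) - x₂ := by linarith
  have newton : (1 - 2 * t) * (y₁ * w₂ - y₂ * w₁) = 0 := by
    linear_combination (hc₁ + hc₃ - hc₂ - hc₄) / 2
  have hp : q₄ = p₃ := by
    rcases mul_eq_zero.1 newton with h | h
    · obtain rfl : t = 1 / 2 := by linarith
      have e₁ : q₄ + p₂ = p₃ + p₄ := eq_of_sq_eq_of_mul_nonneg hD (by linarith) (by linarith)
        (by linear_combination hl₃ - hl₁)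
      have e₂ : p₂ + p₃ = p₄ + q₄ := eq_of_sq_eq_of_mul_nonneg hD (by linarith) (by linarith)
        (by linear_combination hl₄ - hl₂)
      linarith
    · linear_combination hc₂ - hc₁ - 2 * t * h
  subst hp
  linear_combination -(hl₁ - hl₂ + hl₃ - hl₄) / 2

/-- The side lines of a quadrilateral with crossing diagonals support its convex hull. -/
lemma cross_side_nonneg {s t : ℝ} (hs : s ∈ Set.Ioo (0 : ℝ) 1) (ht : t ∈ Set.Ioo (0 : ℝ) 1)
    {X Y Z W : ℝ × ℝ} (h : (1 - s) • X + s • Z = (1 - t) • Y + t • W) {x : ℝ × ℝ}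
    (hx : x ∈ convexHull ℝ {X, Y, Z, W}) :
    0 ≤ planeCross (Z - X) (W - Y) * planeCross (Y - X) (x - X) := by
  have hconv : Convex ℝ
      {x : ℝ × ℝ | 0 ≤ planeCross (Z - X) (W - Y) * planeCross (Y - X) (x - X)} := by
    intro a ha b hb r q hr hq hrq
    obtain rfl : r = 1 - q := by linarith
    simp only [Set.mem_ofPred_eq] at ha hb ⊢
    have : planeCross (Z - X) (W - Y) * planeCross (Y - X) ((1 - q) • a + q • b - X) =
        (1 - q) * (planeCross (Z - X) (W - Y) * planeCross (Y - X) (a - X)) +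
          q * (planeCross (Z - X) (W - Y) * planeCross (Y - X) (b - X)) := by
      simp only [planeCross, Prod.fst_sub, Prod.snd_sub, Prod.fst_add, Prod.snd_add,
        Prod.smul_fst, Prod.smul_snd, smul_eq_mul]
      ring
    rw [this]
    exact add_nonneg (mul_nonneg hr ha) (mul_nonneg hq hb)
  refine convexHull_min ?_ hconv hx
  have h1 := congrArg Prod.fst h
  have h2 := congrArg Prod.snd h
  simp only [Prod.fst_add, Prod.snd_add, Prod.smul_fst, Prod.smul_snd, smul_eq_mul] at h1 h2
  have hZ : planeCross (Y - X) (Z - X) = t * planeCross (Z - X) (W - Y) := by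
    simp only [planeCross, Prod.fst_sub, Prod.snd_sub]
    linear_combination -(Z.2 - X.2) * h1 + (Z.1 - X.1) * h2
  have hW : planeCross (Y - X) (W - X) = s * planeCross (Z - X) (W - Y) := by
    simp only [planeCross, Prod.fst_sub, Prod.snd_sub]
    linear_combination -(W.2 - Y.2) * h1 + (W.1 - Y.1) * h2
  rintro y (rfl | rfl | rfl | rfl) <;> simp only [Set.mem_ofPred_eq]
  · simp [planeCross]
  · simp [planeCross, mul_comm]
  · rw [hZ, mul_left_comm]
    exact mul_nonneg ht.1.le (mul_self_nonneg _)
  · rw [hW, mul_left_comm]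
    exact mul_nonneg hs.1.le (mul_self_nonneg _)

/-- Affinely independent points of the plane span a triangle of nonzero area. -/
lemma planeCross_ne_zero_of_affineIndependent {X Y Z : ℝ × ℝ}
    (h : AffineIndependent ℝ ![X, Y, Z]) : planeCross (Y - X) (Z - X) ≠ 0 := by
  intro h0
  have key : ∀ b c : ℝ, b • (Y - X) + c • (Z - X) = 0 → b = 0 ∧ c = 0 := by
    intro b c hbc
    have hw := affineIndependent_iff.1 h Finset.univ ![-b - c, b, c]
      (by
        simp only [Fin.sum_univ_three, Matrix.cons_val]
        ring)
      (by
        simp only [Fin.sum_univ_three, Matrix.cons_val]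
        rw [← hbc]
        module)
    exact ⟨hw 1 (Finset.mem_univ _), hw 2 (Finset.mem_univ _)⟩
  simp only [planeCross] at h0
  have k1 := key (Z - X).1 (-(Y - X).1) (by
    ext
    · simp only [Prod.fst_add, Prod.smul_fst, smul_eq_mul, Prod.fst_zero]
      ring
    · simp only [Prod.snd_add, Prod.smul_snd, smul_eq_mul, Prod.snd_zero]
      linarith)
  have k2 := key (Z - X).2 (-(Y - X).2) (by
    ext
    · simp only [Prod.fst_add, Prod.smul_fst, smul_eq_mul, Prod.fst_zero]
      linarith
    · simp only [Prod.snd_add, Prod.smul_snd, smul_eq_mul, Prod.snd_zero]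
      ring)
  have hY : Z - X = 0 := Prod.ext k1.1 k2.1
  exact one_ne_zero (key 0 1 (by simp [hY])).2

/-- A four-point set is unchanged by rotating the list of its points. -/
lemma insert_rotate {α : Type*} (a b c d : α) : ({b, c, d, a} : Set α) = {a, b, c, d} := by
  ext
  simp only [Set.mem_insert_iff, Set.mem_singleton_iff]
  tauto

/-- The diagonals of a quadrilateral circumscribed about the unit circle are perpendicular if their
intersection point bisects the diagonal `XZ`. -/
lemma planeDot_diagonals_eq_zero_of_midpoint {X Y Z W : ℝ × ℝ}
    (hD : planeCross (Z - X) (W - Y) ≠ 0) {t : ℝ} (ht : t ∈ Set.Ioo (0 : ℝ) 1)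
    (hM : midpoint ℝ X Z = (1 - t) • Y + t • W)
    (hf : InscribedEllipse (AffineEquiv.refl ℝ (ℝ × ℝ)) X Y Z W) :
    planeDot (Z - X) (W - Y) = 0 := by
  simp only [InscribedEllipse, AffineEquiv.coe_refl, Set.image_id] at hf
  obtain ⟨hsub, ⟨T₁, hT₁, hs₁⟩, ⟨T₂, hT₂, hs₂⟩, ⟨T₃, hT₃, hs₃⟩, ⟨T₄, hT₄, hs₄⟩⟩ := hf
  have hhalf : (1 / 2 : ℝ) ∈ Set.Ioo (0 : ℝ) 1 := by norm_num
  have ht' : 1 - t ∈ Set.Ioo (0 : ℝ) 1 := ⟨by linarith [ht.2], by linarith [ht.1]⟩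
  have hM' : X + Z = (2 : ℝ) • ((1 - t) • Y + t • W) := by
    rw [← hM, midpoint_eq_smul_add, smul_smul]
    simp
  have h₁ : (1 - 1 / 2 : ℝ) • X + (1 / 2 : ℝ) • Z = (1 - t) • Y + t • W := by
    rw [← hM, midpoint_eq_smul_add, invOf_eq_inv]
    module
  have h₂ : (1 - t) • Y + t • W = (1 - 1 / 2 : ℝ) • Z + (1 / 2 : ℝ) • X := by
    rw [← h₁]
    module
  have h₃ : (1 - 1 / 2 : ℝ) • Z + (1 / 2 : ℝ) • X = (1 - (1 - t)) • W + (1 - t) • Y := by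
    rw [← h₂]
    module
  have h₄ : (1 - (1 - t)) • W + (1 - t) • Y = (1 - 1 / 2 : ℝ) • X + (1 / 2 : ℝ) • Z := by
    rw [h₁]
    module
  have e₂ := insert_rotate X Y Z W
  have e₃ := (insert_rotate Y Z W X).trans e₂
  have e₄ := (insert_rotate Z W X Y).trans e₃
  have d₂ : planeCross (W - Y) (X - Z) = planeCross (Z - X) (W - Y) := by
    simp only [planeCross, Prod.fst_sub, Prod.snd_sub]
    ring
  have d₃ : planeCross (X - Z) (Y - W) = planeCross (Z - X) (W - Y) := by
    simp only [planeCross, Prod.fst_sub, Prod.snd_sub]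
    ring
  have d₄ : planeCross (Y - W) (Z - X) = planeCross (Z - X) (W - Y) := by
    simp only [planeCross, Prod.fst_sub, Prod.snd_sub]
    ring
  refine planeDot_diagonals_eq_zero hD hT₁ hT₂ hT₃ hT₄ hs₁ hs₂ hs₃ hs₄
    (fun x hx => cross_side_nonneg hhalf ht h₁ (hsub hx)) (fun x hx => ?_) (fun x hx => ?_)
    (fun x hx => ?_) hM'
  · rw [← d₂]
    exact cross_side_nonneg ht hhalf h₂ (e₂.symm ▸ hsub hx)
  · rw [← d₃]
    exact cross_side_nonneg hhalf ht' h₃ (e₃.symm ▸ hsub hx)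
  · rw [← d₄]
    exact cross_side_nonneg ht' hhalf h₄ (e₄.symm ▸ hsub hx)

/-- Inscribed ellipses are mapped to inscribed ellipses by affine equivalences. -/
lemma InscribedEllipse.map {f : (ℝ × ℝ) ≃ᵃ[ℝ] (ℝ × ℝ)} {A₁ A₂ A₃ A₄ : ℝ × ℝ}
    (hf : InscribedEllipse f A₁ A₂ A₃ A₄) (g : (ℝ × ℝ) ≃ᵃ[ℝ] (ℝ × ℝ)) :
    InscribedEllipse (f.trans g) (g A₁) (g A₂) (g A₃) (g A₄) := by
  have himage : (f.trans g) '' unitCircle = g '' (f '' unitCircle) := by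
    rw [AffineEquiv.coe_trans, Set.image_comp]
  have hseg : ∀ A B : ℝ × ℝ, (∃ p ∈ f '' unitCircle, p ∈ segment ℝ A B) →
      ∃ p ∈ (f.trans g) '' unitCircle, p ∈ segment ℝ (g A) (g B) := by
    rintro A B ⟨p, hp, hpAB⟩
    refine ⟨g p, himage ▸ Set.mem_image_of_mem g hp, ?_⟩
    have := Set.mem_image_of_mem g hpAB
    rwa [← AffineEquiv.coe_toAffineMap, image_segment] at this
  obtain ⟨hsub, h₁, h₂, h₃, h₄⟩ := hf
  refine ⟨?_, hseg _ _ h₁, hseg _ _ h₂, hseg _ _ h₃, hseg _ _ h₄⟩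
  have := Set.image_mono (f := g) hsub
  rw [← himage, ← AffineEquiv.coe_toAffineMap g, AffineMap.image_convexHull] at this
  simpa [Set.image_insert_eq] using this

/-- Listing the vertices from another starting point does not affect inscribed ellipses. -/
lemma InscribedEllipse.rotate {f : (ℝ × ℝ) ≃ᵃ[ℝ] (ℝ × ℝ)} {A₁ A₂ A₃ A₄ : ℝ × ℝ}
    (hf : InscribedEllipse f A₁ A₂ A₃ A₄) : InscribedEllipse f A₂ A₃ A₄ A₁ := by
  obtain ⟨hsub, h₁, h₂, h₃, h₄⟩ := hf
  exact ⟨(insert_rotate A₁ A₂ A₃ A₄).symm ▸ hsub, h₂, h₃, h₄, h₁⟩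

/-- The diagonals of a midpoint diagonal quadrilateral circumscribed about the unit circle are
perpendicular. -/
lemma IsMidpointDiagonalQuad.planeDot_eq_zero {X Y Z W : ℝ × ℝ}
    (h : IsMidpointDiagonalQuad X Y Z W) (hD : planeCross (Z - X) (W - Y) ≠ 0)
    (hf : InscribedEllipse (AffineEquiv.refl ℝ (ℝ × ℝ)) X Y Z W) :
    planeDot (Z - X) (W - Y) = 0 := by
  obtain ⟨P, hXZ, hYW, hP⟩ := h
  rw [openSegment_eq_image] at hXZ hYW
  obtain ⟨s, hs, hsP⟩ := hXZ
  obtain ⟨t, ht, htP⟩ := hYW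
  rcases hP with rfl | rfl
  · exact planeDot_diagonals_eq_zero_of_midpoint hD ht htP.symm hf
  · have hD' : planeCross (W - Y) (X - Z) ≠ 0 := by
      convert hD using 1
      simp only [planeCross, Prod.fst_sub, Prod.snd_sub]
      ring
    have := planeDot_diagonals_eq_zero_of_midpoint hD' (t := 1 - s)
      ⟨by linarith [hs.2], by linarith [hs.1]⟩
      (by
        rw [← hsP]
        module) hf.rotate
    simp only [planeDot, Prod.fst_sub, Prod.snd_sub] at this ⊢
    linarith

/-- Affine equivalences preserve midpoint diagonal quadrilaterals. -/
lemma IsMidpointDiagonalQuad.map {A₁ A₂ A₃ A₄ : ℝ × ℝ}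
    (h : IsMidpointDiagonalQuad A₁ A₂ A₃ A₄) (g : (ℝ × ℝ) ≃ᵃ[ℝ] (ℝ × ℝ)) :
    IsMidpointDiagonalQuad (g A₁) (g A₂) (g A₃) (g A₄) := by
  obtain ⟨P, h₁, h₂, hP⟩ := h
  have hseg : ∀ A B : ℝ × ℝ, P ∈ openSegment ℝ A B → g P ∈ openSegment ℝ (g A) (g B) := by
    intro A B hAB
    have := Set.mem_image_of_mem g hAB
    rwa [← AffineEquiv.coe_toAffineMap, image_openSegment] at this
  refine ⟨g P, hseg _ _ h₁, hseg _ _ h₂, ?_⟩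
  rw [← AffineEquiv.map_midpoint, ← AffineEquiv.map_midpoint]
  exact hP.imp (congrArg g) (congrArg g)

/-- The diagonals of a midpoint diagonal quadrilateral are not parallel if three of its vertices are
affinely independent. -/
lemma IsMidpointDiagonalQuad.planeCross_ne_zero {X Y Z W : ℝ × ℝ}
    (h : IsMidpointDiagonalQuad X Y Z W) (hind : AffineIndependent ℝ ![X, Y, Z]) :
    planeCross (Z - X) (W - Y) ≠ 0 := by
  obtain ⟨P, hXZ, hYW, -⟩ := h
  rw [openSegment_eq_image] at hXZ hYW
  obtain ⟨s, -, hsP⟩ := hXZ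
  obtain ⟨t, -, htP⟩ := hYW
  have h1 := congrArg Prod.fst (hsP.trans htP.symm)
  have h2 := congrArg Prod.snd (hsP.trans htP.symm)
  simp only [Prod.fst_add, Prod.snd_add, Prod.smul_fst, Prod.smul_snd, smul_eq_mul] at h1 h2
  have hZ : planeCross (Y - X) (Z - X) = t * planeCross (Z - X) (W - Y) := by
    simp only [planeCross, Prod.fst_sub, Prod.snd_sub]
    linear_combination -(Z.2 - X.2) * h1 + (Z.1 - X.1) * h2
  intro h0
  exact planeCross_ne_zero_of_affineIndependent hind (by rw [hZ, h0, mul_zero])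

/-- In the plane, a vector orthogonal to `u` is a multiple of any nonzero vector orthogonal
to `u`. -/
lemma exists_eq_smul_of_planeDot_eq_zero {u v m : ℝ × ℝ} (hu : u ≠ 0) (hv : v ≠ 0)
    (huv : planeDot u v = 0) (hum : planeDot u m = 0) : ∃ t : ℝ, m = t • v := by
  obtain ⟨u₁, u₂⟩ := u
  obtain ⟨v₁, v₂⟩ := v
  obtain ⟨m₁, m₂⟩ := m
  simp only [planeDot, ne_eq, Prod.mk_eq_zero, Prod.smul_mk, Prod.mk.injEq, smul_eq_mul] at *
  have hcross : v₁ * m₂ = v₂ * m₁ := by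
    by_cases h1 : u₁ = 0
    · have h2 : u₂ ≠ 0 := fun h2 => hu ⟨h1, h2⟩
      exact mul_left_cancel₀ h2 (by linear_combination v₁ * hum - m₁ * huv)
    · exact mul_left_cancel₀ h1 (by linear_combination m₂ * huv - v₂ * hum)
  by_cases h1 : v₁ = 0
  · have h2 : v₂ ≠ 0 := fun h2 => hv ⟨h1, h2⟩
    refine ⟨m₂ / v₂, ?_, by field_simp⟩
    field_simp
    linarith
  · refine ⟨m₁ / v₁, by field_simp, ?_⟩
    field_simp
    linarith

/-- The midpoint of a chord of the unit circle is orthogonal to the chord. -/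
lemma planeDot_sub_midpoint {a b : ℝ × ℝ} (ha : a ∈ unitCircle) (hb : b ∈ unitCircle) :
    planeDot (a - b) (midpoint ℝ a b) = 0 := by
  simp only [unitCircle, Set.mem_ofPred_eq] at ha hb
  simp only [planeDot, midpoint_eq_smul_add, Prod.fst_sub, Prod.snd_sub, Prod.smul_fst,
    Prod.smul_snd, Prod.fst_add, Prod.snd_add, smul_eq_mul]
  linear_combination ⅟(2 : ℝ) * (ha - hb)

/-- Every ellipse inscribed in a midpoint diagonal quadrilateral has a pair of
conjugate diameters parallel to the two diagonals of the quadrilateral. -/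
theorem stmt14 (A₁ A₂ A₃ A₄ : ℝ × ℝ) (hconv : ConvexQuad A₁ A₂ A₃ A₄)
    (hmdq : IsMidpointDiagonalQuad A₁ A₂ A₃ A₄)
    (f : (ℝ × ℝ) ≃ᵃ[ℝ] (ℝ × ℝ)) (hf : InscribedEllipse f A₁ A₂ A₃ A₄) :
    ConjugateDiameters (f '' unitCircle) (f 0) (A₃ - A₁) (A₄ - A₂) := by
  set g := f.symm
  have hmdq' := hmdq.map g
  have hind : AffineIndependent ℝ ![g A₁, g A₂, g A₃] := by
    have := (AffineEquiv.affineIndependent_iff g).2 hconv.1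
    convert this using 1
    ext i : 1
    fin_cases i <;> rfl
  have hD := hmdq'.planeCross_ne_zero hind
  have hperp : planeDot (g A₃ - g A₁) (g A₄ - g A₂) = 0 := by
    refine hmdq'.planeDot_eq_zero hD ?_
    have := hf.map g
    rwa [AffineEquiv.self_trans_symm] at this
  have hu : g A₃ - g A₁ ≠ 0 := fun h => hD (by simp [h, planeCross])
  have hv : g A₄ - g A₂ ≠ 0 := fun h => hD (by simp [h, planeCross])
  have hlin : ∀ A B : ℝ × ℝ, f.linear (g A - g B) = A - B := by
    intro A B
    simpa [g] using f.toAffineMap.linearMap_vsub (g A) (g B)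
  refine ⟨?_, ?_, ?_⟩
  · rw [← hlin]
    exact f.linear.map_ne_zero_iff.2 hu
  · rw [← hlin]
    exact f.linear.map_ne_zero_iff.2 hv
  · rintro _ _ ⟨a, ha, rfl⟩ ⟨b, hb, rfl⟩ hne ⟨t, ht⟩
    have hab : a - b = t • (g A₃ - g A₁) := by
      apply f.linear.injective
      rw [map_smul, hlin, ← ht]
      simpa using (f.toAffineMap.linearMap_vsub a b)
    have ht0 : t ≠ 0 := by
      rintro rfl
      rw [zero_smul, sub_eq_zero] at ht
      exact hne ht
    have hum : planeDot (g A₃ - g A₁) (midpoint ℝ a b) = 0 := by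
      have := planeDot_sub_midpoint ha hb
      rw [hab] at this
      refine mul_left_cancel₀ ht0 ?_
      rw [mul_zero, ← this]
      simp only [planeDot, Prod.smul_fst, Prod.smul_snd, smul_eq_mul]
      ring
    obtain ⟨r, hr⟩ := exists_eq_smul_of_planeDot_eq_zero hu hv hperp hum
    refine ⟨r, ?_⟩
    rw [← AffineEquiv.map_midpoint, hr, ← hlin A₄ A₂, ← map_smul]
    have := f.map_vadd 0 (r • (g A₄ - g A₂))
    simpa [add_comm] using this
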